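/- Let P be a homogeneous prime ideal in R = k[x_1,...,x_r] with dim(R/P) = 2 and I = in(P) Borel-fixed for some monomial order. Then (x_1,...,x_{r-2}) is a minimal prime of I, and the set of associated primes of R/I is one of: {(x_1,...,x_{r-2})}, {(x_1,...,x_{r-2}),(x_1,...,x_{r-1})}, {(x_1,...,x_{r-2}),(x_1,...,x_{r-1}),(x_1,...,x_r)}. -/

import Mathlib

open MvPolynomial

attribute [local instance] MvPolynomial.gradedAlgebra

/-- The leading exponent (multidegree) of a polynomial w.r.t. a monomial order. -/
noncomputable def MonomialOrder.leadExp {k : Type*} [Field k] {r : ℕ}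
    (m : MonomialOrder (Fin r)) (f : MvPolynomial (Fin r) k) : Fin r →₀ ℕ :=
  m.toSyn.symm (f.support.sup fun d => m.toSyn d)

/-- The initial ideal of `P` w.r.t. a monomial order: the ideal generated by the leading
monomials of the nonzero elements of `P`. -/
noncomputable def MonomialOrder.initialIdeal {k : Type*} [Field k] {r : ℕ}
    (m : MonomialOrder (Fin r)) (P : Ideal (MvPolynomial (Fin r) k)) :
    Ideal (MvPolynomial (Fin r) k) :=
  Ideal.span ((fun f => monomial (m.leadExp f) (1 : k)) '' {f | f ∈ P ∧ f ≠ 0})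

section helpers

variable {k : Type*} [Field k] {r : ℕ}

theorem aux_mon_mem_iff (m : MonomialOrder (Fin r)) (P : Ideal (MvPolynomial (Fin r) k))
    (u : Fin r →₀ ℕ) :
    monomial u (1 : k) ∈ m.initialIdeal P ↔ ∃ f ∈ P, f ≠ 0 ∧ m.degree f = u := by
  classical
  constructor
  · intro h
    have e : m.initialIdeal P = Ideal.span ((fun s => monomial s (1 : k)) ''
        (m.degree '' {f | f ∈ P ∧ f ≠ 0})) := by
      rw [Set.image_image]; rfl
    rw [e, mem_ideal_span_monomial_image] at h
    obtain ⟨s, ⟨f, ⟨hf, hf0⟩, rfl⟩, hle⟩ := h u (by simp [mem_support_iff])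
    have h0 : monomial (u - m.degree f) (1 : k) ≠ 0 := by simp
    refine ⟨monomial (u - m.degree f) 1 * f, P.mul_mem_left _ hf, mul_ne_zero h0 hf0, ?_⟩
    rw [m.degree_mul h0 hf0, m.degree_monomial, if_neg one_ne_zero, tsub_add_cancel_of_le hle]
  · rintro ⟨f, hf, hf0, rfl⟩
    exact Ideal.subset_span ⟨f, ⟨hf, hf0⟩, rfl⟩

theorem aux_mem_iff (m : MonomialOrder (Fin r)) (P : Ideal (MvPolynomial (Fin r) k))
    (g : MvPolynomial (Fin r) k) :
    g ∈ m.initialIdeal P ↔ ∀ u ∈ g.support, monomial u (1 : k) ∈ m.initialIdeal P := by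
  classical
  have e : m.initialIdeal P = Ideal.span ((fun s => monomial s (1 : k)) ''
      (m.degree '' {f | f ∈ P ∧ f ≠ 0})) := by
    rw [Set.image_image]; rfl
  rw [e, mem_ideal_span_monomial_image]
  simp_rw [mem_ideal_span_monomial_image]
  constructor
  · intro h u hu v hv
    rw [support_monomial, if_neg one_ne_zero, Finset.mem_singleton] at hv
    exact hv ▸ h u hu
  · intro h u hu
    exact h u hu u (by simp [mem_support_iff])

theorem aux_mono {I : Ideal (MvPolynomial (Fin r) k)} {u v : Fin r →₀ ℕ} (h : u ≤ v)
    (hu : monomial u (1 : k) ∈ I) : monomial v (1 : k) ∈ I := by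
  have : monomial v (1 : k) = monomial (v - u) 1 * monomial u 1 := by
    rw [monomial_mul, tsub_add_cancel_of_le h, one_mul]
  rw [this]; exact I.mul_mem_left _ hu

/-- closed under elementary moves -/
def AuxBorel (I : Ideal (MvPolynomial (Fin r) k)) : Prop :=
  ∀ (J : Fin r →₀ ℕ) (a : Fin r) (ha : a.val + 1 < r),
      monomial J (1 : k) ∈ I → 0 < J ⟨a.val + 1, ha⟩ →
      monomial (J + Finsupp.single a 1 - Finsupp.single ⟨a.val + 1, ha⟩ 1) (1 : k) ∈ I

theorem AuxBorel.move {I : Ideal (MvPolynomial (Fin r) k)} (hB : AuxBorel I) (n : ℕ) :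
    ∀ (u : Fin r →₀ ℕ) (i j : Fin r), j.val = i.val + n →
      monomial (u + Finsupp.single j 1) (1 : k) ∈ I →
      monomial (u + Finsupp.single i 1) (1 : k) ∈ I := by
  induction n with
  | zero =>
    intro u i j hij h
    have : i = j := Fin.ext (by omega)
    rwa [this]
  | succ n ih =>
    intro u i j hij h
    have hj := j.isLt
    refine ih u i ⟨i.val + n, by omega⟩ rfl ?_
    have e : j = ⟨(⟨i.val + n, by omega⟩ : Fin r).val + 1, by simp; omega⟩ := Fin.ext (by simp; omega)
    rw [e] at h
    have := hB _ ⟨i.val + n, by omega⟩ (by simp; omega) h (by simp)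
    convert this using 2
    rw [add_right_comm, add_tsub_cancel_right]

theorem AuxBorel.moves {I : Ideal (MvPolynomial (Fin r) k)} (hB : AuxBorel I) {i j : Fin r}
    (hij : i ≤ j) (s : ℕ) : ∀ (u : Fin r →₀ ℕ),
      monomial (u + Finsupp.single j s) (1 : k) ∈ I →
      monomial (u + Finsupp.single i s) (1 : k) ∈ I := by
  induction s with
  | zero => intro u h; simpa using h
  | succ s ih =>
    intro u h
    rw [Finsupp.single_add, ← add_assoc] at h ⊢
    have h1 := hB.move (j.val - i.val) _ i j (by have : i.val ≤ j.val := hij; omega) h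
    rw [add_right_comm] at h1 ⊢
    exact ih _ h1

/-- a monomial of I supported in indices ≥ j yields a power of x_j times the rest. -/
theorem AuxBorel.pow_of_supp {I : Ideal (MvPolynomial (Fin r) k)} (hB : AuxBorel I) (j : Fin r)
    (w : Fin r →₀ ℕ) : ∀ (u : Fin r →₀ ℕ), (∀ i, w i ≠ 0 → j ≤ i) →
    monomial (u + w) (1 : k) ∈ I → ∃ s, monomial (u + Finsupp.single j s) (1 : k) ∈ I := by
  classical
  induction w using Finsupp.induction with
  | zero => intro u _ h; exact ⟨0, by simpa using h⟩
  | single_add a b w ha hb ih =>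
    intro u hw h
    have hja : j ≤ a := hw a (by simp [Finsupp.notMem_support_iff.mp ha, hb])
    rw [← add_assoc, add_right_comm] at h
    have h1 := hB.moves hja b _ h
    rw [add_right_comm] at h1
    obtain ⟨s, hs⟩ := ih (u + Finsupp.single j b) (by
      intro i hi
      apply hw i
      simp only [Finsupp.add_apply]
      omega) h1
    refine ⟨b + s, ?_⟩
    rwa [Finsupp.single_add, ← add_assoc]

theorem aux_span (m : MonomialOrder (Fin r)) (P : Ideal (MvPolynomial (Fin r) k))
    (hhom : P.IsHomogeneous (homogeneousSubmodule (Fin r) k)) (u : Fin r →₀ ℕ) :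
    monomial u (1 : k) ∈ restrictSupport k
      {v | monomial v (1 : k) ∉ m.initialIdeal P ∧ v.degree = u.degree} ⊔ P.restrictScalars k := by
  classical
  suffices H : ∀ (a : m.syn) (u : Fin r →₀ ℕ), m.toSyn u = a → monomial u (1 : k) ∈ restrictSupport k
      {v | monomial v (1 : k) ∉ m.initialIdeal P ∧ v.degree = u.degree} ⊔ P.restrictScalars k from
    H _ u rfl
  intro a
  induction a using WellFoundedLT.induction with
  | ind a ih =>
  intro u hu
  by_cases hE : monomial u (1 : k) ∈ m.initialIdeal P
  · obtain ⟨f, hf, hf0, hfu⟩ := (aux_mon_mem_iff m P u).1 hE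
    have hh := homogeneousComponent_mem_of_mem hhom hf u.degree
    set h := homogeneousComponent u.degree f with hh_def
    have hlc : f.coeff u ≠ 0 := by
      rw [← hfu]; exact m.coeff_degree_ne_zero_iff.2 hf0
    set q := monomial u (1 : k) - C (f.coeff u)⁻¹ * h with hq
    have hcq : ∀ v, q.coeff v = (if u = v then 1 else 0) -
        (f.coeff u)⁻¹ * (if v.degree = u.degree then f.coeff v else 0) := by
      intro v
      rw [hq, coeff_sub, coeff_C_mul, hh_def, coeff_homogeneousComponent, coeff_monomial]
    have e : monomial u (1 : k) = q + C (f.coeff u)⁻¹ * h := by rw [hq]; ring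
    rw [e]
    refine Submodule.add_mem _ ?_ (Submodule.mem_sup_right (P.mul_mem_left _ hh))
    rw [q.as_sum]
    refine Submodule.sum_mem _ fun v hv => ?_
    rw [mem_support_iff, hcq] at hv
    have hvu : u ≠ v := by
      rintro rfl
      simp [hlc] at hv
    rw [if_neg hvu] at hv
    have hd : v.degree = u.degree := by
      by_contra hd
      simp [hd] at hv
    rw [if_pos hd] at hv
    have hfv : f.coeff v ≠ 0 := by
      intro h0
      simp [h0] at hv
    have hle := m.le_degree (mem_support_iff.2 hfv)
    rw [hfu] at hle
    have hlt : m.toSyn v < a := by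
      rw [← hu]
      exact lt_of_le_of_ne hle (fun hc => hvu (m.toSyn.injective hc).symm)
    have := ih _ hlt v rfl
    rw [hd] at this
    have e2 : monomial v (q.coeff v) = (q.coeff v) • monomial v (1 : k) := by
      rw [smul_monomial, smul_eq_mul, mul_one]
    rw [e2]
    exact Submodule.smul_mem _ _ this
  · refine Submodule.mem_sup_left ?_
    rw [mem_restrictSupport_iff]
    intro v hv
    have hv : v ∈ (monomial u (1 : k)).support := hv
    rw [support_monomial, if_neg one_ne_zero, Finset.mem_singleton] at hv
    subst hv
    exact ⟨hE, rfl⟩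

/-- no nonzero element of P is supported off the initial ideal -/
theorem aux_std_zero (m : MonomialOrder (Fin r)) (P : Ideal (MvPolynomial (Fin r) k))
    (f : MvPolynomial (Fin r) k) (hf : f ∈ P)
    (h : ∀ u ∈ f.support, monomial u (1 : k) ∉ m.initialIdeal P) : f = 0 := by
  by_contra h0
  exact h _ (m.degree_mem_support h0) ((aux_mon_mem_iff m P _).2 ⟨f, hf, h0, rfl⟩)

theorem aux_ringKrullDim_eq {A B : Type*} [CommRing A] [CommRing B] [IsDomain A] [IsDomain B]
    [Algebra A B]
    [Algebra.IsIntegral A B] (hinj : Function.Injective (algebraMap A B)) :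
    ringKrullDim B = ringKrullDim A := by
  apply le_antisymm
  · exact Order.krullDim_le_of_strictMono (PrimeSpectrum.comap (algebraMap A B))
      (fun p q h => Ideal.IsIntegral.comap_lt_comap (R := A) h)
  · refine iSup_le fun l => ?_
    have : FaithfulSMul A B := (faithfulSMul_iff_algebraMap_injective A B).2 hinj
    obtain ⟨Q, hQ, hQ'⟩ := Ideal.exists_ideal_over_prime_of_isIntegral_of_isDomain (S := B)
      (RelSeries.head l).asIdeal (by
        rw [(RingHom.injective_iff_ker_eq_bot _).1 hinj]; exact bot_le)
    have : Q.LiesOver (RelSeries.head l).asIdeal := ⟨hQ'.symm⟩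
    obtain ⟨L, hL, -, -⟩ := Ideal.exists_ltSeries_of_hasGoingUp l Q
    rw [← hL]
    exact le_iSup (fun p : LTSeries (PrimeSpectrum B) => ((p.length : ℕ∞) : WithBot ℕ∞)) L

theorem aux_dim (m : MonomialOrder (Fin r)) (P : Ideal (MvPolynomial (Fin r) k)) [hP : P.IsPrime]
    (hhom : P.IsHomogeneous (homogeneousSubmodule (Fin r) k)) (c : ℕ)
    (hlow : ∀ i : Fin r, i.val < c → ∃ s, monomial (Finsupp.single i s) (1 : k) ∈ m.initialIdeal P)
    (hhigh : ∀ u : Fin r →₀ ℕ, monomial u (1 : k) ∈ m.initialIdeal P → ∃ i, i.val < c ∧ u i ≠ 0) :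
    ringKrullDim (MvPolynomial (Fin r) k ⧸ P) = ((Nat.card {i : Fin r // c ≤ i.val} : ℕ) : WithBot ℕ∞) := by
  classical
  let A := MvPolynomial {i : Fin r // c ≤ i.val} k
  let φ : A →ₐ[k] (MvPolynomial (Fin r) k ⧸ P) :=
    (Ideal.Quotient.mkₐ k P).comp (rename Subtype.val)
  let instA : Algebra A (MvPolynomial (Fin r) k ⧸ P) := φ.toRingHom.toAlgebra
  let instM : Module A (MvPolynomial (Fin r) k ⧸ P) := instA.toModule
  have hφ : ∀ a : A, algebraMap A (MvPolynomial (Fin r) k ⧸ P) a =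
    Ideal.Quotient.mk P (rename Subtype.val a) := fun a => rfl
  have hinj : Function.Injective (algebraMap A (MvPolynomial (Fin r) k ⧸ P)) := by
    rw [injective_iff_map_eq_zero]
    intro a ha
    rw [hφ, Ideal.Quotient.eq_zero_iff_mem] at ha
    have h0 := aux_std_zero m P _ ha (by
      intro u hu hE
      obtain ⟨i, hi, hui⟩ := hhigh u hE
      rw [support_rename_of_injective Subtype.val_injective, Finset.mem_image] at hu
      obtain ⟨d, -, rfl⟩ := hu
      apply hui
      apply Finsupp.mapDomain_of_notMem_range
      rintro ⟨⟨j, hj⟩, rfl⟩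
      simp at hi
      omega)
    exact rename_injective _ Subtype.val_injective (by rw [h0, map_zero])
  choose! s hs using hlow
  let N : Fin r →₀ ℕ := Finsupp.equivFunOnFinite.symm (fun i => if i.val < c then s i else 0)
  have hfin : Module.Finite A (MvPolynomial (Fin r) k ⧸ P) := by
    refine ⟨⟨(Finset.Iic N).image (fun b => Ideal.Quotient.mk P (monomial b (1 : k))), ?_⟩⟩
    rw [eq_top_iff]
    have key : ∀ v, monomial v (1 : k) ∉ m.initialIdeal P →
        Ideal.Quotient.mk P (monomial v (1 : k)) ∈ Submodule.span A
          (((Finset.Iic N).image (fun b => Ideal.Quotient.mk P (monomial b (1 : k))) :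
            Finset (MvPolynomial (Fin r) k ⧸ P)) : Set (MvPolynomial (Fin r) k ⧸ P)) := by
      intro v hv
      let b : Fin r →₀ ℕ := v.filter (fun i => i.val < c)
      let a : {i : Fin r // c ≤ i.val} →₀ ℕ := v.comapDomain Subtype.val Subtype.val_injective.injOn
      have hva : v = Finsupp.mapDomain Subtype.val a + b := by
        ext i
        rw [Finsupp.add_apply]
        by_cases hi : i.val < c
        · have e1 : b i = v i := Finsupp.filter_apply_pos (fun i : Fin r => i.val < c) v hi
          rw [Finsupp.mapDomain_of_notMem_range, e1, zero_add]
          rintro ⟨⟨j, hj⟩, rfl⟩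
          simp at hi; omega
        · have e1 : b i = 0 := Finsupp.filter_apply_neg (fun i : Fin r => i.val < c) v hi
          rw [e1, add_zero]
          exact (Finsupp.mapDomain_apply Subtype.val_injective a ⟨i, not_lt.1 hi⟩).symm
      have hbN : b ≤ N := by
        intro i
        by_cases hi : i.val < c
        · have e1 : b i = v i := Finsupp.filter_apply_pos (fun i : Fin r => i.val < c) v hi
          have e2 : N i = s i := by simp [N, hi]
          rw [e1, e2]
          by_contra hlt
          refine hv (aux_mono ?_ (hs i hi))
          rw [Finsupp.single_le_iff]
          omega
        · have e1 : b i = 0 := Finsupp.filter_apply_neg (fun i : Fin r => i.val < c) v hi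
          rw [e1]; exact Nat.zero_le _
      have e : Ideal.Quotient.mk P (monomial v (1 : k)) =
          (monomial a (1 : k) : A) • Ideal.Quotient.mk P (monomial b (1 : k)) := by
        rw [Algebra.smul_def, hφ, rename_monomial, ← map_mul, monomial_mul, one_mul, ← hva]
      rw [e]
      refine Submodule.smul_mem _ _ (Submodule.subset_span ?_)
      rw [Finset.coe_image]
      exact ⟨b, by simpa using hbN, rfl⟩
    have hC : ∀ (x : k) (f : MvPolynomial (Fin r) k), Ideal.Quotient.mk P (C x * f) =
        (C x : A) • Ideal.Quotient.mk P f := by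
      intro x f
      rw [Algebra.smul_def, hφ, rename_C, map_mul]
    have key2 : ∀ g : MvPolynomial (Fin r) k,
        (∀ v ∈ g.support, Ideal.Quotient.mk P (monomial v (1 : k)) ∈ Submodule.span A
          (((Finset.Iic N).image (fun b => Ideal.Quotient.mk P (monomial b (1 : k))) :
            Finset (MvPolynomial (Fin r) k ⧸ P)) : Set (MvPolynomial (Fin r) k ⧸ P))) →
        Ideal.Quotient.mk P g ∈ Submodule.span A
          (((Finset.Iic N).image (fun b => Ideal.Quotient.mk P (monomial b (1 : k))) :
            Finset (MvPolynomial (Fin r) k ⧸ P)) : Set (MvPolynomial (Fin r) k ⧸ P)) := by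
      intro g hg
      rw [g.as_sum, map_sum]
      refine Submodule.sum_mem _ fun v hv => ?_
      have e2 : monomial v (g.coeff v) = C (g.coeff v) * monomial v (1 : k) := by
        rw [C_mul_monomial, mul_one]
      rw [e2, hC]
      exact Submodule.smul_mem _ _ (hg v hv)
    rintro x -
    obtain ⟨f, rfl⟩ := Ideal.Quotient.mk_surjective x
    refine key2 f fun u _ => ?_
    obtain ⟨g, hg, p, hp, hgp⟩ := Submodule.mem_sup.1 (aux_span m P hhom u)
    have hp' : p ∈ P := hp
    rw [← hgp, map_add, Ideal.Quotient.eq_zero_iff_mem.2 hp', add_zero]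
    rw [mem_restrictSupport_iff] at hg
    exact key2 g fun v hv => key v (hg hv).1
  have : Algebra.IsIntegral A (MvPolynomial (Fin r) k ⧸ P) := Algebra.IsIntegral.of_finite _ _
  rw [aux_ringKrullDim_eq hinj, MvPolynomial.ringKrullDim_of_isNoetherianRing,
    ringKrullDim_eq_zero_of_field, zero_add]

theorem aux_split (f : MvPolynomial (Fin r) k) (Q : (Fin r →₀ ℕ) → Prop) :
    ∃ f1 f2, f = f1 + f2 ∧ (∀ u ∈ f1.support, u ∈ f.support ∧ Q u) ∧
      (∀ u ∈ f2.support, u ∈ f.support ∧ ¬ Q u) := by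
  classical
  refine ⟨∑ u ∈ f.support with Q u, monomial u (f.coeff u),
    ∑ u ∈ f.support with ¬ Q u, monomial u (f.coeff u), ?_, ?_, ?_⟩
  · rw [Finset.sum_filter_add_sum_filter_not]; exact f.as_sum
  all_goals
    intro u hu
    obtain ⟨v, hv, huv⟩ := Finset.mem_biUnion.1 (support_sum hu)
    have := Finset.mem_singleton.1 (support_monomial_subset huv)
    subst this
    exact Finset.mem_filter.1 hv

theorem aux_down (S : Set (Fin r)) (hS : ∀ i j, i ≤ j → j ∈ S → i ∈ S) :
    ∃ c, c ≤ r ∧ ∀ i : Fin r, i ∈ S ↔ i.val < c := by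
  classical
  have hex : ∃ n, ∀ i ∈ S, i.val < n := ⟨r, fun i _ => i.isLt⟩
  refine ⟨Nat.find hex, Nat.find_min' hex fun i _ => i.isLt, fun i => ⟨Nat.find_spec hex i, ?_⟩⟩
  intro hi
  have := Nat.find_min hex hi
  push Not at this
  obtain ⟨j, hj, hij⟩ := this
  exact hS i j hij hj

/-- the prime generated by the first `j` variables -/
noncomputable abbrev auxp (k : Type*) [Field k] (r j : ℕ) : Ideal (MvPolynomial (Fin r) k) :=
  Ideal.span ((fun i => (X i : MvPolynomial (Fin r) k)) '' {i : Fin r | i.val < j})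

theorem mem_auxp (j : ℕ) (g : MvPolynomial (Fin r) k) :
    g ∈ auxp k r j ↔ ∀ u ∈ g.support, ∃ i : Fin r, i.val < j ∧ u i ≠ 0 := by
  have := mem_ideal_span_X_image (x := g) (s := {i : Fin r | i.val < j})
  exact this

theorem auxp_prime (m : MonomialOrder (Fin r)) (j : ℕ) : (auxp k r j).IsPrime := by
  classical
  refine ⟨?_, ?_⟩
  · rw [Ne, Ideal.eq_top_iff_one, mem_auxp]
    intro h
    obtain ⟨i, -, hi⟩ := h 0 (by simp)
    simp at hi
  · intro f g hfg
    by_contra hcon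
    push Not at hcon
    obtain ⟨hf, hg⟩ := hcon
    obtain ⟨f1, f2, rfl, hf1, hf2⟩ := aux_split f (fun u => ∃ i : Fin r, i.val < j ∧ u i ≠ 0)
    obtain ⟨g1, g2, rfl, hg1, hg2⟩ := aux_split g (fun u => ∃ i : Fin r, i.val < j ∧ u i ≠ 0)
    have hf1' : f1 ∈ auxp k r j := (mem_auxp _ _).2 fun u hu => (hf1 u hu).2
    have hg1' : g1 ∈ auxp k r j := (mem_auxp _ _).2 fun u hu => (hg1 u hu).2
    have h2 : f2 * g2 ∈ auxp k r j := by
      have e : f2 * g2 = (f1 + f2) * (g1 + g2) - f1 * (g1 + g2) - f2 * g1 := by ring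
      rw [e]
      exact sub_mem (sub_mem hfg (Ideal.mul_mem_right _ _ hf1')) (Ideal.mul_mem_left _ _ hg1')
    have hf0 : f2 ≠ 0 := by
      rintro rfl
      exact hf (by simpa using hf1')
    have hg0 : g2 ≠ 0 := by
      rintro rfl
      exact hg (by simpa using hg1')
    have hd := m.degree_mem_support (mul_ne_zero hf0 hg0)
    rw [m.degree_mul hf0 hg0] at hd
    obtain ⟨i, hi, hne⟩ := (mem_auxp _ _).1 h2 _ hd
    have h3 := (hf2 _ (m.degree_mem_support hf0)).2
    have h4 := (hg2 _ (m.degree_mem_support hg0)).2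
    push Not at h3 h4
    exact hne (by rw [Finsupp.add_apply, h3 i hi, h4 i hi])

theorem aux_ass_iff (I p : Ideal (MvPolynomial (Fin r) k)) :
    p ∈ associatedPrimes (MvPolynomial (Fin r) k) (MvPolynomial (Fin r) k ⧸ I) ↔
      p.IsPrime ∧ ∃ f, ∀ g, g ∈ p ↔ g * f ∈ I := by
  rw [AssociatedPrimes.mem_iff, isAssociatedPrime_iff]
  refine and_congr_right fun _ => ?_
  have key : ∀ f g : MvPolynomial (Fin r) k, g ∈ (⊥ : Submodule (MvPolynomial (Fin r) k)
      (MvPolynomial (Fin r) k ⧸ I)).colon {Ideal.Quotient.mk I f} ↔ g * f ∈ I := by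
    intro f g
    rw [Submodule.mem_colon_singleton, Submodule.mem_bot, ← Ideal.Quotient.eq_zero_iff_mem, map_mul]
    rfl
  constructor
  · rintro ⟨x, rfl⟩
    obtain ⟨f, rfl⟩ := Ideal.Quotient.mk_surjective x
    exact ⟨f, key f⟩
  · rintro ⟨f, hf⟩
    exact ⟨Ideal.Quotient.mk I f, Ideal.ext fun g => (hf g).trans (key f g).symm⟩

/-- `I` is a monomial ideal -/
def AuxMon (I : Ideal (MvPolynomial (Fin r) k)) : Prop :=
  ∀ g, g ∈ I ↔ ∀ u ∈ g.support, monomial u (1 : k) ∈ I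

theorem aux_mem_support_mul (g : MvPolynomial (Fin r) k) (u v : Fin r →₀ ℕ) :
    v ∈ (g * monomial u (1 : k)).support ↔ ∃ w ∈ g.support, v = w + u := by
  classical
  rw [mem_support_iff, coeff_mul_monomial', mul_one]
  constructor
  · intro h
    by_cases huv : u ≤ v
    · rw [if_pos huv] at h
      exact ⟨v - u, mem_support_iff.2 h, (tsub_add_cancel_of_le huv).symm⟩
    · rw [if_neg huv] at h
      exact absurd rfl h
  · rintro ⟨w, hw, rfl⟩
    rw [if_pos le_add_self, add_tsub_cancel_right]
    exact mem_support_iff.1 hw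

theorem AuxMon.mul_mem {I : Ideal (MvPolynomial (Fin r) k)} (hM : AuxMon I)
    (g : MvPolynomial (Fin r) k) (u : Fin r →₀ ℕ) :
    g * monomial u (1 : k) ∈ I ↔ ∀ w ∈ g.support, monomial (w + u) (1 : k) ∈ I := by
  rw [hM]
  constructor
  · intro h w hw
    exact h _ ((aux_mem_support_mul _ _ _).2 ⟨w, hw, rfl⟩)
  · intro h v hv
    obtain ⟨w, hw, rfl⟩ := (aux_mem_support_mul _ _ _).1 hv
    exact h w hw

theorem aux_ass_form (m : MonomialOrder (Fin r)) {I : Ideal (MvPolynomial (Fin r) k)}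
    (hM : AuxMon I) (hB : AuxBorel I) {p : Ideal (MvPolynomial (Fin r) k)}
    (hp : p ∈ associatedPrimes (MvPolynomial (Fin r) k) (MvPolynomial (Fin r) k ⧸ I)) :
    ∃ j, j ≤ r ∧ p = auxp k r j := by
  classical
  obtain ⟨hprime, f, hf⟩ := (aux_ass_iff I p).1 hp
  have hX : ∀ (i : Fin r) (s : ℕ) (h : MvPolynomial (Fin r) k), X i ^ s * h ∈ I ↔
      ∀ w ∈ h.support, monomial (w + Finsupp.single i s) (1 : k) ∈ I := by
    intro i s h
    rw [X_pow_eq_monomial, mul_comm, hM.mul_mem]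
  obtain ⟨j, hjr, hj⟩ := aux_down {i : Fin r | X i ∈ p} (by
    intro i j hij hjS
    have hjS : X j ∈ p := hjS
    change X i ∈ p
    rw [hf, ← pow_one (X _), hX] at hjS ⊢
    exact fun w hw => hB.moves hij 1 w (hjS w hw))
  have hle : auxp k r j ≤ p := by
    rw [Ideal.span_le]
    rintro _ ⟨i, hi, rfl⟩
    exact (hj i).2 hi
  refine ⟨j, hjr, le_antisymm ?_ hle⟩
  intro g hg
  obtain ⟨g1, g2, rfl, hg1, hg2⟩ := aux_split g (fun u => ∃ i : Fin r, i.val < j ∧ u i ≠ 0)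
  have hg1' : g1 ∈ auxp k r j := (mem_auxp _ _).2 fun u hu => (hg1 u hu).2
  suffices h : g2 = 0 by rw [h, add_zero]; exact hg1'
  have hg2p : g2 ∈ p := by
    have := sub_mem hg (hle hg1')
    rwa [add_sub_cancel_left] at this
  by_contra hg0
  have hdeg := (hg2 _ (m.degree_mem_support hg0)).2
  push Not at hdeg
  rcases hjr.eq_or_lt with hjr' | hjr'
  · have h0 : m.degree g2 = 0 := by
      ext i
      exact hdeg i (by have := i.isLt; omega)
    have hC := m.eq_C_of_degree_eq_zero h0
    apply hprime.ne_top
    refine Ideal.eq_top_of_isUnit_mem _ hg2p ?_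
    rw [hC]
    exact (isUnit_iff_ne_zero.2 (m.leadingCoeff_ne_zero_iff.2 hg0)).map C
  · let l : Fin r := ⟨j, hjr'⟩
    have hl : X l ∉ p := fun h => by
      have := (hj l).1 h
      simp [l] at this
    obtain ⟨f1, f2, hf12, hf1, hf2⟩ := aux_split f
      (fun u => ∃ s, monomial (u + Finsupp.single l s) (1 : k) ∈ I)
    have hf1s : ∃ s, X l ^ s * f1 ∈ I := by
      have : ∀ u, ∃ s, u ∈ f1.support → monomial (u + Finsupp.single l s) (1 : k) ∈ I := by
        intro u
        by_cases hu : u ∈ f1.support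
        · obtain ⟨s, hs⟩ := (hf1 u hu).2
          exact ⟨s, fun _ => hs⟩
        · exact ⟨0, fun h => absurd h hu⟩
      choose s hs using this
      refine ⟨∑ u ∈ f1.support, s u, ?_⟩
      rw [hX]
      intro w hw
      refine aux_mono ?_ (hs w hw)
      gcongr
      exact Finset.single_le_sum (f := s) (fun _ _ => Nat.zero_le _) hw
    obtain ⟨s, hs⟩ := hf1s
    have hf20 : f2 ≠ 0 := by
      rintro rfl
      rw [add_zero] at hf12
      rw [← hf12, ← hf] at hs
      exact hl (hprime.mem_of_pow_mem _ hs)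
    have h1 : X l ^ s * (g2 * f2) ∈ I := by
      have e : X l ^ s * (g2 * f2) = X l ^ s * (g2 * f) - g2 * (X l ^ s * f1) := by
        rw [hf12]; ring
      rw [e]
      exact sub_mem (I.mul_mem_left _ ((hf _).1 hg2p)) (I.mul_mem_left _ hs)
    rw [hX] at h1
    have hd := m.degree_mem_support (mul_ne_zero hg0 hf20)
    rw [m.degree_mul hg0 hf20] at hd
    have h2 := h1 _ hd
    rw [add_comm (m.degree g2), add_assoc] at h2
    refine (hf2 _ (m.degree_mem_support hf20)).2 ?_
    refine hB.pow_of_supp l _ _ ?_ h2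
    intro i hi
    by_contra hil
    have hil' : i.val < j := by
      have : i < l := not_le.1 hil
      exact this
    apply hi
    rw [Finsupp.add_apply, hdeg i hil', Finsupp.single_eq_of_ne (by
      rintro rfl
      simp [l] at hil'), add_zero]

theorem aux_bound {I : Ideal (MvPolynomial (Fin r) k)} (hB : AuxBorel I) (z : Fin r)
    (hz : ∀ i, i ≤ z) : ∃ D, ∀ v : Fin r →₀ ℕ,
      (∃ s, monomial (v + Finsupp.single z s) (1 : k) ∈ I) → D ≤ v.degree →
      monomial v (1 : k) ∈ I := by
  classical
  let S : Set (Fin r →₀ ℕ) := {v | ∃ s, monomial (v + Finsupp.single z s) (1 : k) ∈ I}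
  have hfg : (Ideal.span ((fun s => monomial s (1 : k)) '' S)).FG := IsNoetherian.noetherian _
  obtain ⟨T', hT', hspan⟩ := (Submodule.fg_span_iff_fg_span_finset_subset _).1 hfg
  obtain ⟨T, hTS, hT⟩ : ∃ T : Finset (Fin r →₀ ℕ), (T : Set (Fin r →₀ ℕ)) ⊆ S ∧
      T.image (fun s => monomial s (1 : k)) = T' := by
    obtain ⟨T, h1, h2⟩ := Finset.subset_set_image_iff.1 hT'
    exact ⟨T, h1, h2⟩
  have hgen : ∀ v ∈ S, ∃ t ∈ T, t ≤ v := by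
    intro v hv
    have h1 : monomial v (1 : k) ∈ Ideal.span ((fun s => monomial s (1 : k)) '' S) :=
      Ideal.subset_span ⟨v, hv, rfl⟩
    have h2 : monomial v (1 : k) ∈ Ideal.span ((fun s => monomial s (1 : k)) '' (T : Set (Fin r →₀ ℕ))) := by
      rw [← Finset.coe_image, hT]
      have e : Ideal.span ((fun s => monomial s (1 : k)) '' S) = Ideal.span (T' : Set _) := hspan
      rwa [e] at h1
    rw [mem_ideal_span_monomial_image] at h2
    obtain ⟨t, ht, hle⟩ := h2 v (by simp)
    exact ⟨t, ht, hle⟩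
  have : ∀ t, ∃ s, t ∈ S → monomial (t + Finsupp.single z s) (1 : k) ∈ I := by
    intro t
    by_cases ht : t ∈ S
    · obtain ⟨s, hs⟩ := ht
      exact ⟨s, fun _ => hs⟩
    · exact ⟨0, fun h => absurd h ht⟩
  choose s hs using this
  refine ⟨∑ t ∈ T, (t.degree + r * s t) + 1, ?_⟩
  intro v hv hD
  obtain ⟨t, htT, htv⟩ := hgen v hv
  have hle := Finset.single_le_sum (f := fun t : Fin r →₀ ℕ => t.degree + r * s t)
    (fun _ _ => Nat.zero_le _) htT
  obtain ⟨w, rfl⟩ := exists_add_of_le htv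
  have hdeg : (t + w).degree = t.degree + w.degree := map_add _ _ _
  have hw : ∃ i, s t ≤ w i := by
    by_contra hcon
    push Not at hcon
    have h1 : w.degree ≤ r * s t := by
      rw [Finsupp.degree_eq_sum]
      calc ∑ i, w i ≤ ∑ _i : Fin r, s t := Finset.sum_le_sum fun i _ => (hcon i).le
        _ = r * s t := by simp
    omega
  obtain ⟨i, hi⟩ := hw
  refine aux_mono ?_ (hB.moves (hz i) (s t) t (hs t (hTS htT)))
  gcongr
  rwa [Finsupp.single_le_iff]

theorem aux_key (m : MonomialOrder (Fin r)) (P : Ideal (MvPolynomial (Fin r) k)) [hP : P.IsPrime]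
    (hhom : P.IsHomogeneous (homogeneousSubmodule (Fin r) k)) (hB : AuxBorel (m.initialIdeal P))
    (y z : Fin r) (hyz : y ≠ z) (hz : ∀ i, i ≤ z) (hyP : X y ∉ P)
    (H : ∀ u s, monomial (u + Finsupp.single y s) (1 : k) ∈ m.initialIdeal P →
      ∃ t, monomial (u + Finsupp.single z t) (1 : k) ∈ m.initialIdeal P)
    (u : Fin r →₀ ℕ) (s : ℕ)
    (hu : monomial (u + Finsupp.single z s) (1 : k) ∈ m.initialIdeal P) :
    monomial u (1 : k) ∈ m.initialIdeal P := by
  classical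
  by_contra hE
  obtain ⟨D, hD⟩ := aux_bound hB z hz
  -- the saturation
  set Q : (Fin r →₀ ℕ) → Prop :=
    fun v => ∃ t, monomial (v + Finsupp.single z t) (1 : k) ∈ m.initialIdeal P with hQ
  have hQE : ∀ v, monomial v (1 : k) ∈ m.initialIdeal P → Q v := fun v hv =>
    ⟨0, by simpa using hv⟩
  have hQmono : ∀ v w, Q v → Q (v + w) := by
    rintro v w ⟨t, ht⟩
    refine ⟨t, aux_mono ?_ ht⟩
    rw [add_right_comm]
    exact le_self_add
  have hQz : ∀ v n, Q (v + Finsupp.single z n) → Q v := by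
    rintro v n ⟨t, ht⟩
    refine ⟨n + t, ?_⟩
    rwa [Finsupp.single_add, ← add_assoc]
  have hQy : ∀ v n, Q (v + Finsupp.single y n) → Q v := by
    rintro v n ⟨t, ht⟩
    rw [add_right_comm] at ht
    obtain ⟨t', ht'⟩ := H _ _ ht
    refine ⟨t + t', ?_⟩
    rwa [Finsupp.single_add, ← add_assoc]
  have hred : ∀ x : Fin r, ∃ f : MvPolynomial (Fin r) k, (∀ v ∈ f.support, ¬ Q v) ∧
      monomial (u + Finsupp.single x D) (1 : k) - f ∈ P := by
    intro x
    obtain ⟨f, hf, p, hp, hfp⟩ := Submodule.mem_sup.1 (aux_span m P hhom (u + Finsupp.single x D))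
    refine ⟨f, ?_, ?_⟩
    · intro v hv hQv
      rw [mem_restrictSupport_iff] at hf
      obtain ⟨h1, h2⟩ := hf hv
      refine h1 (hD v hQv ?_)
      rw [h2, map_add, Finsupp.degree_single]
      omega
    · rw [← hfp, add_sub_cancel_left]; exact hp
  obtain ⟨f, hf, hfP⟩ := hred y
  obtain ⟨g, hg, hgP⟩ := hred z
  have hh : f * monomial (Finsupp.single z D) (1 : k) - g * monomial (Finsupp.single y D) (1 : k) ∈ P := by
    have e : f * monomial (Finsupp.single z D) (1 : k) - g * monomial (Finsupp.single y D) (1 : k) =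
        monomial (Finsupp.single y D) (1 : k) * (monomial (u + Finsupp.single z D) (1 : k) - g) -
        monomial (Finsupp.single z D) (1 : k) * (monomial (u + Finsupp.single y D) (1 : k) - f) := by
      have e1 : monomial (Finsupp.single y D) (1 : k) * monomial (u + Finsupp.single z D) (1 : k) =
        monomial (Finsupp.single z D) (1 : k) * monomial (u + Finsupp.single y D) (1 : k) := by
        rw [monomial_mul, monomial_mul]
        congr 2
        abel
      rw [mul_sub, mul_sub, e1]; ring
    rw [e]
    exact sub_mem (P.mul_mem_left _ hgP) (P.mul_mem_left _ hfP)
  have hh0 := aux_std_zero m P _ hh (by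
    intro v hv hvE
    have hQv := hQE v hvE
    rcases Finset.mem_union.1 (support_sub (Fin r) _ _ hv) with h | h
    · obtain ⟨w, hw, rfl⟩ := (aux_mem_support_mul _ _ _).1 h
      exact hf w hw (hQz _ _ hQv)
    · obtain ⟨w, hw, rfl⟩ := (aux_mem_support_mul _ _ _).1 h
      exact hg w hw (hQy _ _ hQv))
  have heq := sub_eq_zero.1 hh0
  have hdiv : ∀ v ∈ f.support, Finsupp.single y D ≤ v := by
    intro v hv
    have h1 := (aux_mem_support_mul f (Finsupp.single z D) _).2 ⟨v, hv, rfl⟩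
    rw [heq] at h1
    obtain ⟨w, -, hw⟩ := (aux_mem_support_mul _ _ _).1 h1
    rw [Finsupp.single_le_iff]
    have := DFunLike.congr_fun hw y
    simp only [Finsupp.add_apply, Finsupp.single_eq_same, Finsupp.single_eq_of_ne hyz] at this
    omega
  let f' : MvPolynomial (Fin r) k := ∑ v ∈ f.support, monomial (v - Finsupp.single y D) (f.coeff v)
  have hf' : f = monomial (Finsupp.single y D) (1 : k) * f' := by
    conv_lhs => rw [f.as_sum]
    rw [Finset.mul_sum]
    refine Finset.sum_congr rfl fun v hv => ?_
    rw [monomial_mul, one_mul, add_tsub_cancel_of_le (hdiv v hv)]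
  have hf'Q : ∀ w ∈ f'.support, ¬ Q w := by
    intro w hw hQw
    obtain ⟨v, hv, hwv⟩ := Finset.mem_biUnion.1 (support_sum hw)
    have := Finset.mem_singleton.1 (support_monomial_subset hwv)
    subst this
    have h1 := hQmono _ (Finsupp.single y D) hQw
    rw [tsub_add_cancel_of_le (hdiv v hv)] at h1
    exact hf v hv h1
  have hmem : monomial u (1 : k) - f' ∈ P := by
    have h1 : X y ^ D * (monomial u (1 : k) - f') ∈ P := by
      rw [X_pow_eq_monomial, mul_sub, ← hf', monomial_mul, one_mul, add_comm]
      exact hfP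
    rcases hP.mem_or_mem h1 with h | h
    · exact absurd (hP.mem_of_pow_mem _ h) hyP
    · exact h
  have hzero := aux_std_zero m P _ hmem (by
    intro v hv hvE
    rcases Finset.mem_union.1 (support_sub (Fin r) _ _ hv) with h | h
    · have := Finset.mem_singleton.1 (support_monomial_subset h)
      subst this
      exact hE hvE
    · exact hf'Q v h (hQE v hvE))
  have := sub_eq_zero.1 hzero
  refine hf'Q u ?_ ⟨s, hu⟩
  rw [← this]
  simp

theorem aux_ass_pred (m : MonomialOrder (Fin r)) {I : Ideal (MvPolynomial (Fin r) k)}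
    (hM : AuxMon I) (hB : AuxBorel I) (y z : Fin r) (hy : y.val + 2 = r) (hz : z.val + 1 = r)
    (hnot : auxp k r (r - 1) ∉
      associatedPrimes (MvPolynomial (Fin r) k) (MvPolynomial (Fin r) k ⧸ I))
    (u : Fin r →₀ ℕ) (s : ℕ) (hu : monomial (u + Finsupp.single y s) (1 : k) ∈ I) :
    ∃ t, monomial (u + Finsupp.single z t) (1 : k) ∈ I := by
  classical
  by_contra hcon
  apply hnot
  have hex : ∃ s, ∃ t, monomial (u + Finsupp.single y s + Finsupp.single z t) (1 : k) ∈ I :=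
    ⟨s, 0, by simpa using hu⟩
  obtain ⟨t, ht⟩ := Nat.find_spec hex
  have hmin := fun n => Nat.find_min hex (m := n)
  rcases hn : Nat.find hex with _ | n
  · rw [hn] at ht
    exact absurd ⟨t, by simpa using ht⟩ hcon
  · have hn' := hmin n (by omega)
    rw [hn] at ht
    let w := u + Finsupp.single y n + Finsupp.single z t
    have hw1 : monomial (w + Finsupp.single y 1) (1 : k) ∈ I := by
      convert ht using 2
      simp only [w, Finsupp.single_add]
      abel
    have hw2 : ∀ t', monomial (w + Finsupp.single z t') (1 : k) ∉ I := by
      intro t' h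
      refine hn' ⟨t + t', ?_⟩
      rwa [Finsupp.single_add, ← add_assoc]
    refine (aux_ass_iff _ _).2 ⟨auxp_prime m _, monomial w 1, fun g => ?_⟩
    rw [mem_auxp, hM.mul_mem]
    refine forall₂_congr fun v hv => ?_
    constructor
    · rintro ⟨i, hi, hvi⟩
      have hiy : i ≤ y := Fin.le_def.2 (by omega)
      refine aux_mono ?_ (hB.moves hiy 1 w hw1)
      rw [add_comm]
      gcongr
      rw [Finsupp.single_le_iff]
      omega
    · intro h
      by_contra hno
      push Not at hno
      have hv : v = Finsupp.single z (v z) := by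
        ext i
        by_cases hi : i.val < r - 1
        · rw [hno i hi, Finsupp.single_eq_of_ne]
          rintro rfl
          omega
        · have : i = z := Fin.ext (by have := i.isLt; omega)
          rw [this, Finsupp.single_eq_same]
      rw [hv, add_comm] at h
      exact hw2 _ h

end helpers

/-- if `P` is a homogeneous prime with `dim(R/P) = 2` and `I = in(P)` is
Borel-fixed, then `(x_1,...,x_{r-2})` is a minimal prime of `I`, and the set of associated
primes of `R/I` is `{(x_1,...,x_{r-2})}`, `{(x_1,...,x_{r-2}),(x_1,...,x_{r-1})}`, or
`{(x_1,...,x_{r-2}),(x_1,...,x_{r-1}),(x_1,...,x_r)}`. -/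
theorem associated_primes_of_initial_ideal_dim_two {k : Type*} [Field k] {r : ℕ}
    (P : Ideal (MvPolynomial (Fin r) k)) (hP : P.IsPrime)
    (hhom : P.IsHomogeneous (homogeneousSubmodule (Fin r) k))
    (hdim : ringKrullDim (MvPolynomial (Fin r) k ⧸ P) = 2)
    (m : MonomialOrder (Fin r)) (I : Ideal (MvPolynomial (Fin r) k))
    (hI : I = m.initialIdeal P)
    (hborel : ∀ (J : Fin r →₀ ℕ) (a : Fin r) (ha : a.val + 1 < r),
      monomial J (1 : k) ∈ I → 0 < J ⟨a.val + 1, ha⟩ →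
      monomial (J + Finsupp.single a 1 - Finsupp.single ⟨a.val + 1, ha⟩ 1) (1 : k) ∈ I) :
    Ideal.span ((fun i => (X i : MvPolynomial (Fin r) k)) '' {i : Fin r | i.val < r - 2}) ∈
        I.minimalPrimes ∧
      (associatedPrimes (MvPolynomial (Fin r) k) (MvPolynomial (Fin r) k ⧸ I) =
          {Ideal.span ((fun i => (X i : MvPolynomial (Fin r) k)) '' {i : Fin r | i.val < r - 2})} ∨
        associatedPrimes (MvPolynomial (Fin r) k) (MvPolynomial (Fin r) k ⧸ I) =
          {Ideal.span ((fun i => (X i : MvPolynomial (Fin r) k)) '' {i : Fin r | i.val < r - 2}),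
            Ideal.span ((fun i => (X i : MvPolynomial (Fin r) k)) '' {i : Fin r | i.val < r - 1})} ∨
        associatedPrimes (MvPolynomial (Fin r) k) (MvPolynomial (Fin r) k ⧸ I) =
          {Ideal.span ((fun i => (X i : MvPolynomial (Fin r) k)) '' {i : Fin r | i.val < r - 2}),
            Ideal.span ((fun i => (X i : MvPolynomial (Fin r) k)) '' {i : Fin r | i.val < r - 1}),
            Ideal.span ((fun i => (X i : MvPolynomial (Fin r) k)) '' {i : Fin r | i.val < r})}) := by
  classical
  have := hP
  subst hI
  have hB : AuxBorel (m.initialIdeal P) := hborel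
  have hM : AuxMon (m.initialIdeal P) := aux_mem_iff m P
  set I := m.initialIdeal P with hIdef
  have h1 : monomial (0 : Fin r →₀ ℕ) (1 : k) ∉ I := by
    intro h
    obtain ⟨f, hf, hf0, hdeg⟩ := (aux_mon_mem_iff m P 0).1 h
    apply hP.ne_top
    refine Ideal.eq_top_of_isUnit_mem _ hf ?_
    rw [m.eq_C_of_degree_eq_zero hdeg]
    exact (isUnit_iff_ne_zero.2 (m.leadingCoeff_ne_zero_iff.2 hf0)).map C
  obtain ⟨c, hcr, hc⟩ := aux_down {i : Fin r | ∃ s, monomial (Finsupp.single i s) (1 : k) ∈ I} (by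
    rintro i j hij ⟨s, hs⟩
    refine ⟨s, ?_⟩
    have := hB.moves hij s 0 (by simpa using hs)
    simpa using this)
  have hhigh : ∀ u : Fin r →₀ ℕ, monomial u (1 : k) ∈ I → ∃ i, i.val < c ∧ u i ≠ 0 := by
    intro u hu
    by_contra hno
    push Not at hno
    rcases hcr.eq_or_lt with h | h
    · have : u = 0 := by
        ext i
        exact hno i (by have := i.isLt; omega)
      exact h1 (this ▸ hu)
    · obtain ⟨s, hs⟩ := hB.pow_of_supp ⟨c, h⟩ u 0 (by
        intro i hi
        by_contra hlt
        exact hi (hno i (not_le.1 hlt))) (by simpa using hu)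
      have := (hc ⟨c, h⟩).1 ⟨s, by simpa using hs⟩
      simp at this
  have hd := aux_dim m P hhom c (fun i hi => (hc i).2 hi) hhigh
  have hcard : Nat.card {i : Fin r // c ≤ i.val} = r - c := by
    have e : Nat.card {i : Fin r // c ≤ i.val} + Nat.card {i : Fin r // ¬ c ≤ i.val} = r := by
      rw [← Nat.card_sum, Nat.card_congr (Equiv.sumCompl _)]; simp
    have e2 : Nat.card {i : Fin r // ¬ c ≤ i.val} = c := by
      rw [Nat.card_congr (β := Fin c) ⟨fun i => ⟨i.1.val, not_le.1 i.2⟩,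
        fun i => ⟨⟨i.val, by omega⟩, by simp⟩, fun i => rfl, fun i => rfl⟩]
      simp
    omega
  rw [hdim, hcard] at hd
  have hd2 : r - c = 2 := by exact_mod_cast hd.symm
  have hcr2 : c = r - 2 := by omega
  have hr2 : 2 ≤ r := by omega
  subst hcr2
  have hmin : auxp k r (r - 2) ∈ I.minimalPrimes := by
    refine ⟨⟨auxp_prime m _, ?_⟩, ?_⟩
    · intro g hg
      exact (mem_auxp _ _).2 fun u hu => hhigh u ((hM g).1 hg u hu)
    · rintro q ⟨hq, hIq⟩ -
      rw [Ideal.span_le]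
      rintro _ ⟨i, hi, rfl⟩
      obtain ⟨s, hs⟩ := (hc i).2 hi
      rw [← X_pow_eq_monomial] at hs
      exact hq.mem_of_pow_mem _ (hIq hs)
  refine ⟨hmin, ?_⟩
  change _ = {auxp k r (r - 2)} ∨ _ = {auxp k r (r - 2), auxp k r (r - 1)} ∨
    _ = {auxp k r (r - 2), auxp k r (r - 1), auxp k r r}
  set Ass := associatedPrimes (MvPolynomial (Fin r) k) (MvPolynomial (Fin r) k ⧸ I) with hAss
  have hA1 : auxp k r (r - 2) ∈ Ass := by
    apply Module.associatedPrimes.minimalPrimes_annihilator_subset_associatedPrimes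
    rwa [Ideal.annihilator_quotient]
  have hA2 : ∀ p ∈ Ass, p = auxp k r (r - 2) ∨ p = auxp k r (r - 1) ∨ p = auxp k r r := by
    intro p hp
    obtain ⟨j, hj, rfl⟩ := aux_ass_form m hM hB hp
    have hle : I ≤ auxp k r j := by
      obtain ⟨-, f, hf⟩ := (aux_ass_iff _ _).1 hp
      intro g hg
      exact (hf g).2 (I.mul_mem_right _ hg)
    have hj2 : r - 2 ≤ j := by
      by_contra hlt
      push Not at hlt
      obtain ⟨s, hs⟩ := (hc ⟨j, by omega⟩).2 hlt
      obtain ⟨i, hi, hne⟩ := (mem_auxp _ _).1 (hle hs) (Finsupp.single ⟨j, by omega⟩ s) (by simp)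
      apply hne
      rw [Finsupp.single_eq_of_ne]
      rintro rfl
      simp at hi
    have : j = r - 2 ∨ j = r - 1 ∨ j = r := by omega
    rcases this with h | h | h <;> simp [h]
  have hA3 : auxp k r r ∈ Ass → auxp k r (r - 1) ∈ Ass := by
    intro hr
    by_contra hnot
    let y : Fin r := ⟨r - 2, by omega⟩
    let z : Fin r := ⟨r - 1, by omega⟩
    have hyP : X y ∉ P := by
      intro h
      have hE : monomial (Finsupp.single y 1) (1 : k) ∈ I := by
        refine (aux_mon_mem_iff m P _).2 ⟨X y, h, X_ne_zero _, m.degree_X⟩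
      have := (hc y).1 ⟨1, hE⟩
      simp [y] at this
    obtain ⟨hpr, f, hf⟩ := (aux_ass_iff _ _).1 hr
    have hzf : X z * f ∈ I := (hf _).1 (Ideal.subset_span ⟨z, z.isLt, rfl⟩)
    apply hpr.ne_top
    rw [Ideal.eq_top_iff_one, hf, one_mul, hM]
    intro u hu
    have hzf' : f * monomial (Finsupp.single z 1) (1 : k) ∈ I := by rwa [mul_comm]
    refine aux_key m P hhom hB y z (by simp [y, z, Fin.ext_iff]; omega)
      (fun i => Fin.le_def.2 (by have := i.isLt; simp only [z]; omega)) hyP ?_ u 1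
      ((hM.mul_mem _ _).1 hzf' u hu)
    exact aux_ass_pred m hM hB y z (by simp only [y]; omega) (by simp only [z]; omega) hnot
  by_cases hb : auxp k r (r - 1) ∈ Ass
  · by_cases hr : auxp k r r ∈ Ass
    · right; right
      refine Set.Subset.antisymm (fun p hp => by simpa using hA2 p hp) ?_
      rintro p (rfl | rfl | rfl) <;> assumption
    · right; left
      refine Set.Subset.antisymm (fun p hp => ?_) ?_
      · rcases hA2 p hp with h | h | h
        · exact Or.inl h
        · exact Or.inr h
        · exact absurd (h ▸ hp) hr
      · rintro p (rfl | rfl) <;> assumption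
  · left
    refine Set.Subset.antisymm (fun p hp => ?_) ?_
    · rcases hA2 p hp with h | h | h
      · exact h
      · exact absurd (h ▸ hp) hb
      · exact absurd (hA3 (h ▸ hp)) hb
    · rintro p rfl; assumption
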